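/- arXiv:2604.24460 — 2 statements merged into one kernel-verified Lean document; each statement's English description precedes it below -/
import Mathlib

section
/- Let ρ be a density matrix on ℂ³ ⊗ ℂ³ (positive semidefinite with trace 1) such that ρ^Γ is not positive semidefinite and ρ^Γ has at least two non-positive eigenvalues counting multiplicities. Then there exists a vector |φ⟩ ∈ ℂ³ ⊗ ℂ³ of Schmidt rank 2 such that ⟨φ|ρ^Γ|φ⟩ < 0. -/
open Matrix BigOperators Complex Kronecker
open scoped ComplexOrder

/-- Partial transpose on the second tensor factor:
`(ρ^Γ)_{(i,j),(k,l)} = ρ_{(i,l),(k,j)}`. -/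
def PT {d : ℕ} (ρ : Matrix (ZMod d × ZMod d) (ZMod d × ZMod d) ℂ) :
    Matrix (ZMod d × ZMod d) (ZMod d × ZMod d) ℂ :=
  Matrix.of fun p q => ρ (p.1, q.2) (q.1, p.2)

/-- A vector in `ℂ^d ⊗ ℂ^d` has Schmidt rank 2:
`φ = μ₀ a₀ ⊗ b₀ + μ₁ a₁ ⊗ b₁` with `μ₀ ≥ μ₁ > 0` and orthonormal pairs. -/
def SchmidtRank2 {d : ℕ} [NeZero d] (φ : ZMod d × ZMod d → ℂ) : Prop :=
  ∃ (μ₀ μ₁ : ℝ) (a b : Fin 2 → ZMod d → ℂ),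
    μ₁ ≤ μ₀ ∧ 0 < μ₁ ∧
    (∀ i j, star (a i) ⬝ᵥ a j = if i = j then 1 else 0) ∧
    (∀ i j, star (b i) ⬝ᵥ b j = if i = j then 1 else 0) ∧
    φ = fun p => (μ₀ : ℂ) * a 0 p.1 * b 0 p.2 + (μ₁ : ℂ) * a 1 p.1 * b 1 p.2

lemma aux_det_expand (Y W : Matrix (Fin 3) (Fin 3) ℂ) (t : ℂ) :
    (Y + t • W).det = Y.det + t * (Y.adjugate * W).trace + t ^ 2 * (W.adjugate * Y).trace
      + t ^ 3 * W.det := by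
  simp only [Matrix.det_fin_three, Matrix.adjugate_fin_three, Matrix.trace_fin_three,
    Matrix.mul_apply, Fin.sum_univ_three, Matrix.add_apply, Matrix.smul_apply, smul_eq_mul,
    Matrix.of_apply, Matrix.cons_val]
  ring

lemma aux_adj_expand (V X W : Matrix (Fin 3) (Fin 3) ℂ) : ∃ c1 : ℂ, ∀ e : ℂ,
    ((V + e • X).adjugate * W).trace = (V.adjugate * W).trace + c1 * e
      + (X.adjugate * W).trace * e ^ 2 := by
  refine ⟨((V + X).adjugate * W).trace - (V.adjugate * W).trace - (X.adjugate * W).trace, ?_⟩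
  intro e
  simp only [Matrix.adjugate_fin_three, Matrix.trace_fin_three,
    Matrix.mul_apply, Fin.sum_univ_three, Matrix.add_apply, Matrix.smul_apply, smul_eq_mul,
    Matrix.of_apply, Matrix.cons_val]
  ring

lemma aux_exists_X (W : Matrix (Fin 3) (Fin 3) ℂ) (hW : W ≠ 0) :
    ∃ X : Matrix (Fin 3) (Fin 3) ℂ, (X.adjugate * W).trace ≠ 0 := by
  have : ∃ i j, W i j ≠ 0 := by
    by_contra! h
    exact hW (by ext i j; simpa using h i j)
  obtain ⟨i, j, hij⟩ := this
  refine ⟨Matrix.of fun a b => if a = i ∨ b = j then 0 else if ((b : ℕ) + i) % 3 = ((a : ℕ) + j) % 3 then 1 else 0, ?_⟩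
  convert hij using 1
  simp only [Matrix.adjugate_fin_three, Matrix.trace_fin_three,
    Matrix.mul_apply, Fin.sum_univ_three, Matrix.of_apply, Matrix.cons_val]
  fin_cases i <;> fin_cases j <;> simp [Fin.ext_iff]

lemma aux_singular (V W : Matrix (Fin 3) (Fin 3) ℂ) (hW : W ≠ 0) :
    ∃ X : Matrix (Fin 3) (Fin 3) ℂ, ∀ δ : ℝ, 0 < δ → ∃ e : ℝ, 0 < e ∧ e < δ ∧ ∃ t : ℂ,
      ((V + (e : ℂ) • X) + t • W).det = 0 := by
  obtain ⟨X, hX⟩ := aux_exists_X W hW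
  refine ⟨X, fun δ hδ => ?_⟩
  obtain ⟨c1, hc⟩ := aux_adj_expand V X W
  have h1 : ∃ e : ℝ, 0 < e ∧ e < δ ∧ ((V + (e : ℂ) • X).adjugate * W).trace ≠ 0 := by
    by_contra! h
    let p : Polynomial ℂ := Polynomial.C ((V.adjugate * W).trace)
      + Polynomial.C c1 * Polynomial.X + Polynomial.C ((X.adjugate * W).trace) * Polynomial.X ^ 2
    have hp : p = 0 := by
      apply Polynomial.eq_zero_of_infinite_isRoot
      have hinf : ((fun e : ℝ => (e : ℂ)) '' Set.Ioo 0 δ).Infinite :=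
        (Set.Ioo_infinite hδ).image (Complex.ofReal_injective.injOn)
      refine hinf.mono ?_
      rintro _ ⟨e, he, rfl⟩
      have := h e he.1 he.2
      rw [hc] at this
      simpa [p, Polynomial.IsRoot] using this
    have := congrArg (fun q => Polynomial.coeff q 2) hp
    simp [p] at this
    exact hX this
  obtain ⟨e, he, heδ, hne⟩ := h1
  refine ⟨e, he, heδ, ?_⟩
  generalize V + (e : ℂ) • X = Y at hne
  let q : Polynomial ℂ := Polynomial.C Y.det + Polynomial.C ((Y.adjugate * W).trace) * Polynomial.X
    + Polynomial.C ((W.adjugate * Y).trace) * Polynomial.X ^ 2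
    + Polynomial.C W.det * Polynomial.X ^ 3
  have hq : q.degree ≠ 0 := by
    intro h
    have h0 := Polynomial.eq_C_of_degree_eq_zero h
    have := congrArg (fun q => Polynomial.coeff q 1) h0
    simp [q, Polynomial.coeff_X, Polynomial.coeff_C, Polynomial.coeff_X_pow] at this
    exact hne this
  obtain ⟨t, ht⟩ := IsAlgClosed.exists_root q hq
  refine ⟨t, ?_⟩
  rw [aux_det_expand]
  simp [q, Polynomial.IsRoot] at ht
  linear_combination ht

lemma aux_triple : ∀ k : ZMod 3, ∃ k1 k2 : ZMod 3, k1 ≠ k2 ∧ k1 ≠ k ∧ k2 ≠ k ∧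
    Finset.univ = ({k, k1, k2} : Finset (ZMod 3)) := by decide

/-- Schmidt decomposition of a singular coefficient matrix. -/
lemma aux_schmidt (A : Matrix (ZMod 3) (ZMod 3) ℂ) (hA : A.det = 0) :
    (∃ x y : ZMod 3 → ℂ, A = Matrix.of fun i j => x i * y j) ∨
      SchmidtRank2 (fun p : ZMod 3 × ZMod 3 => A p.1 p.2) := by
  have hP : (Aᴴ * A).PosSemidef := Matrix.posSemidef_conjTranspose_mul_self A
  have hB := hP.isHermitian
  let l := hB.eigenvalues
  let u : ZMod 3 → ZMod 3 → ℂ := fun k => (hB.eigenvectorBasis k).ofLp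
  have hl : ∀ k, 0 ≤ l k := hP.eigenvalues_nonneg
  have hu : ∀ k m, star (u k) ⬝ᵥ u m = if k = m then 1 else 0 := by
    intro k m
    have := orthonormal_iff_ite.mp hB.eigenvectorBasis.orthonormal k m
    rw [EuclideanSpace.inner_eq_star_dotProduct] at this
    rw [dotProduct_comm]
    exact this
  have hMu : ∀ k, (Aᴴ * A) *ᵥ u k = (l k : ℂ) • u k := by
    intro k
    have := hB.mulVec_eigenvectorBasis k
    simpa using this
  have hAu : ∀ k m, star (A *ᵥ u k) ⬝ᵥ (A *ᵥ u m) = if k = m then (l k : ℂ) else 0 := by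
    intro k m
    rw [Matrix.star_mulVec, ← Matrix.dotProduct_mulVec, Matrix.mulVec_mulVec, hMu,
      dotProduct_smul, hu]
    by_cases h : k = m <;> simp [h]
  -- resolution of the identity
  have hres : ∀ i j, A i j = ∑ k, (A *ᵥ u k) i * star (u k j) := by
    intro i j
    let U : Matrix (ZMod 3) (ZMod 3) ℂ := Matrix.of fun a k => u k a
    have hU : Uᴴ * U = 1 := by
      ext a b
      have := hu a b
      simpa [Matrix.mul_apply, U, dotProduct, Matrix.one_apply] using this
    have hU2 : U * Uᴴ = 1 := mul_eq_one_comm.mp hU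
    have : A = (A * U) * Uᴴ := by rw [Matrix.mul_assoc, hU2, Matrix.mul_one]
    have := congrFun (congrFun this i) j
    rw [this, Matrix.mul_apply]
    rfl
  have hz : ∀ k, l k = 0 → A *ᵥ u k = 0 := by
    intro k hk
    have := hAu k k
    simp only [if_true, hk, Complex.ofReal_zero] at this
    exact dotProduct_star_self_eq_zero.mp this
  have h0 : ∃ k, l k = 0 := by
    have hd : (Aᴴ * A).det = 0 := by rw [Matrix.det_mul, hA, mul_zero]
    rw [hB.det_eq_prod_eigenvalues] at hd
    obtain ⟨k, -, hk⟩ := Finset.prod_eq_zero_iff.mp hd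
    exact ⟨k, by simpa using hk⟩
  obtain ⟨k, hk⟩ := h0
  obtain ⟨k1, k2, h12, h1, h2, huniv⟩ := aux_triple k
  have hdec : ∀ i j, A i j = (A *ᵥ u k1) i * star (u k1 j) + (A *ᵥ u k2) i * star (u k2 j) := by
    intro i j
    rw [hres i j, huniv, Finset.sum_insert (by simp [h1.symm, h2.symm]),
      Finset.sum_insert (by simp [h12]), Finset.sum_singleton, hz k hk]
    simp
  -- main construction, ordered
  have key : ∀ k1 k2, k1 ≠ k2 → l k2 ≤ l k1 →
      (∀ i j, A i j = (A *ᵥ u k1) i * star (u k1 j) + (A *ᵥ u k2) i * star (u k2 j)) →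
      (∃ x y : ZMod 3 → ℂ, A = Matrix.of fun i j => x i * y j) ∨
      SchmidtRank2 (fun p : ZMod 3 × ZMod 3 => A p.1 p.2) := by
    intro k1 k2 h12 hle hdec
    by_cases hk2 : l k2 = 0
    · left
      refine ⟨A *ᵥ u k1, star (u k1), ?_⟩
      ext i j
      rw [hdec i j, hz k2 hk2]
      simp
    right
    have hp2 : 0 < l k2 := lt_of_le_of_ne (hl k2) (Ne.symm hk2)
    have hp1 : 0 < l k1 := hp2.trans_le hle
    let K : Fin 2 → ZMod 3 := ![k1, k2]
    have hK : ∀ i j, K i = K j ↔ i = j := by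
      intro i j
      fin_cases i <;> fin_cases j <;> simp [K, h12, h12.symm]
    have hKp : ∀ i, 0 < l (K i) := by
      intro i
      fin_cases i <;> simp [K, hp1, hp2]
    have hsq : ∀ i, ((Real.sqrt (l (K i)) : ℝ) : ℂ) ≠ 0 := fun i =>
      Complex.ofReal_ne_zero.mpr (Real.sqrt_pos.mpr (hKp i)).ne'
    refine ⟨Real.sqrt (l k1), Real.sqrt (l k2),
      fun i => ((Real.sqrt (l (K i)) : ℝ) : ℂ)⁻¹ • (A *ᵥ u (K i)), fun i => star (u (K i)),
      Real.sqrt_le_sqrt hle, Real.sqrt_pos.mpr hp2, ?_, ?_, ?_⟩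
    · intro i j
      rw [star_smul, smul_dotProduct, dotProduct_smul, hAu]
      by_cases hij : i = j
      · subst hij
        have := hsq i
        have h3 : ((l (K i) : ℝ) : ℂ) = (Real.sqrt (l (K i)) : ℂ) * (Real.sqrt (l (K i)) : ℂ) := by
          rw [← Complex.ofReal_mul, Real.mul_self_sqrt (hl _)]
        simp only [if_true, smul_eq_mul, star_inv₀, Complex.star_def, Complex.conj_ofReal]
        rw [h3]
        field_simp
      · simp [hij, hK]
    · intro i j
      rw [star_star, dotProduct_comm, hu]
      simp [hK, eq_comm]
    · funext p
      have e1 := hsq 0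
      have e2 := hsq 1
      simp only [K, Matrix.cons_val_zero, Matrix.cons_val_one] at e1 e2
      rw [hdec p.1 p.2]
      simp only [K, Matrix.cons_val_zero, Matrix.cons_val_one, Pi.smul_apply, smul_eq_mul,
        Pi.star_apply]
      rw [mul_inv_cancel_left₀ e1, mul_inv_cancel_left₀ e2]
  rcases le_total (l k2) (l k1) with h | h
  · exact key k1 k2 h12 h hdec
  · exact key k2 k1 h12.symm h (fun i j => by rw [hdec i j, add_comm])

lemma aux_product (ρ : Matrix (ZMod 3 × ZMod 3) (ZMod 3 × ZMod 3) ℂ) (hρ : ρ.PosSemidef)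
    (x y : ZMod 3 → ℂ) :
    0 ≤ star (fun p : ZMod 3 × ZMod 3 => x p.1 * y p.2) ⬝ᵥ
      (PT ρ *ᵥ (fun p : ZMod 3 × ZMod 3 => x p.1 * y p.2)) := by
  have h := hρ.dotProduct_mulVec_nonneg (fun p : ZMod 3 × ZMod 3 => x p.1 * star (y p.2))
  convert h using 1
  simp only [dotProduct, Matrix.mulVec, Finset.mul_sum, Fintype.sum_prod_type, PT, Matrix.of_apply,
    Pi.star_apply, star_mul', star_star]
  refine Finset.sum_congr rfl fun i _ => ?_
  rw [Finset.sum_comm]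
  conv_rhs => rw [Finset.sum_comm]
  refine Finset.sum_congr rfl fun k _ => ?_
  rw [Finset.sum_comm]
  refine Finset.sum_congr rfl fun j _ => Finset.sum_congr rfl fun l _ => ?_
  ring

/-- If `ρ` is a density matrix on `ℂ³ ⊗ ℂ³` with `ρ^Γ` not positive semidefinite and
`ρ^Γ` has at least two non-positive eigenvalues counting multiplicities, then `ρ` is
1-distillable: there is a Schmidt-rank-2 vector `φ` with `⟨φ|ρ^Γ|φ⟩ < 0`. -/
theorem stmt1 (ρ : Matrix (ZMod 3 × ZMod 3) (ZMod 3 × ZMod 3) ℂ)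
    (hρ : ρ.PosSemidef) (htr : ρ.trace = 1)
    (hH : (PT ρ).IsHermitian)
    (hNPT : ¬ (PT ρ).PosSemidef)
    (h2 : ∃ i j, i ≠ j ∧ hH.eigenvalues i ≤ 0 ∧ hH.eigenvalues j ≤ 0) :
    ∃ φ : ZMod 3 × ZMod 3 → ℂ, SchmidtRank2 φ ∧
      ∃ r : ℝ, r < 0 ∧ star φ ⬝ᵥ (PT ρ *ᵥ φ) = (r : ℂ) := by
  have hneg : ∃ k, hH.eigenvalues k < 0 := by
    by_contra! h
    exact hNPT (hH.posSemidef_iff_eigenvalues_nonneg.mpr h)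
  obtain ⟨k, hk⟩ := hneg
  obtain ⟨m, hmk, hm⟩ : ∃ m, m ≠ k ∧ hH.eigenvalues m ≤ 0 := by
    obtain ⟨i, j, hij, hi, hj⟩ := h2
    by_cases h : i = k
    · exact ⟨j, fun h' => hij (h.trans h'.symm), hj⟩
    · exact ⟨i, h, hi⟩
  have hu : ∀ k m, star (hH.eigenvectorBasis k).ofLp ⬝ᵥ (hH.eigenvectorBasis m).ofLp
      = if k = m then 1 else 0 := by
    intro k m
    have := orthonormal_iff_ite.mp hH.eigenvectorBasis.orthonormal k m
    rw [EuclideanSpace.inner_eq_star_dotProduct] at this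
    rw [dotProduct_comm]
    exact this
  have hMu : ∀ k, PT ρ *ᵥ (hH.eigenvectorBasis k).ofLp
      = (hH.eigenvalues k : ℂ) • (hH.eigenvectorBasis k).ofLp := by
    intro k
    simpa using hH.mulVec_eigenvectorBasis k
  have hww := hu m m
  have hwv := hu m k
  have hvv := hu k k
  have hMv := hMu k
  have hMw := hMu m
  rw [if_pos rfl] at hww hvv
  rw [if_neg hmk] at hwv
  generalize (hH.eigenvectorBasis k).ofLp = v at *
  change ZMod 3 × ZMod 3 → ℂ at v
  generalize (hH.eigenvectorBasis m).ofLp = w at *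
  change ZMod 3 × ZMod 3 → ℂ at w
  generalize hH.eigenvalues k = a at *
  generalize hH.eigenvalues m = b at *
  clear hu hMu h2
  -- the modified form, with `w` in its kernel
  let N : Matrix (ZMod 3 × ZMod 3) (ZMod 3 × ZMod 3) ℂ :=
    PT ρ - (b : ℂ) • Matrix.vecMulVec w (star w)
  have hNy : ∀ y, N *ᵥ y = PT ρ *ᵥ y - ((b : ℂ) * (star w ⬝ᵥ y)) • w := by
    intro y
    simp only [N, Matrix.sub_mulVec, Matrix.smul_mulVec, Matrix.vecMulVec_mulVec, mul_smul]
    congr 2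
    exact op_smul_eq_smul _ _
  have hNw : N *ᵥ w = 0 := by
    rw [hNy, hMw, hww]; simp
  have hNH : N.IsHermitian := by
    refine hH.sub ?_
    ext i j
    simp [Matrix.vecMulVec_apply, mul_comm]
  have hwN : star w ᵥ* N = 0 := by
    have := congrArg star hNw
    rw [Matrix.star_mulVec, hNH.eq] at this
    simpa using this
  let q : (ZMod 3 × ZMod 3 → ℂ) → ℂ := fun y => star y ⬝ᵥ (N *ᵥ y)
  have hqt : ∀ (y : ZMod 3 × ZMod 3 → ℂ) (t : ℂ), q (y + t • w) = q y := by
    intro y t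
    have : star w ⬝ᵥ (N *ᵥ y) = 0 := by rw [Matrix.dotProduct_mulVec, hwN, zero_dotProduct]
    simp only [q, Matrix.mulVec_add, Matrix.mulVec_smul, hNw, smul_zero, add_zero, star_add,
      star_smul, add_dotProduct, smul_dotProduct, this]
  have hqv : q v = a := by
    simp only [q, hNy, hMv, hwv]
    simp [hvv]
  have hQ : ∀ y, (star y ⬝ᵥ (PT ρ *ᵥ y)).re ≤ (q y).re := by
    intro y
    have h1 : star y ⬝ᵥ w = star (star w ⬝ᵥ y) := by
      rw [Matrix.star_dotProduct]
    simp only [q, hNy, dotProduct_sub, dotProduct_smul, h1, smul_eq_mul, Complex.sub_re]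
    have h2 : (b : ℂ) * (star w ⬝ᵥ y) * star (star w ⬝ᵥ y)
        = ((b * Complex.normSq (star w ⬝ᵥ y) : ℝ) : ℂ) := by
      rw [mul_assoc, Complex.star_def, Complex.mul_conj]; push_cast; rfl
    rw [h2, Complex.ofReal_re]
    have := mul_nonpos_of_nonpos_of_nonneg hm (Complex.normSq_nonneg (star w ⬝ᵥ y))
    linarith
  let mat : (ZMod 3 × ZMod 3 → ℂ) → Matrix (ZMod 3) (ZMod 3) ℂ := fun y => Matrix.of fun i j => y (i, j)
  have hWne : mat w ≠ 0 := by
    intro h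
    have : w = 0 := by
      funext p
      exact congrFun (congrFun h p.1) p.2
    rw [this] at hww
    simp at hww
  obtain ⟨X, hX⟩ := aux_singular (mat v) (mat w) hWne
  let x : ZMod 3 × ZMod 3 → ℂ := fun p => X p.1 p.2
  have hcont : Continuous fun e : ℝ => (q (v + (e : ℂ) • x)).re := by
    simp only [q, dotProduct, Matrix.mulVec]
    simp only [Pi.add_apply, Pi.smul_apply, Pi.star_apply]
    fun_prop
  have hev : ∀ᶠ e : ℝ in nhds 0, (q (v + (e : ℂ) • x)).re < 0 := by
    refine hcont.continuousAt.eventually_lt continuousAt_const ?_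
    simpa [hqv] using hk
  obtain ⟨δ, hδ, hball⟩ := Metric.eventually_nhds_iff.mp hev
  obtain ⟨e, he, heδ, t, ht⟩ := hX δ hδ
  have hqe := hball (y := e) (by simpa [abs_of_pos he] using heδ)
  let φ : ZMod 3 × ZMod 3 → ℂ := (v + (e : ℂ) • x) + t • w
  have hdet : (mat φ).det = 0 := ht
  have hφ : (star φ ⬝ᵥ (PT ρ *ᵥ φ)).re < 0 := by
    refine (hQ φ).trans_lt ?_
    rw [hqt]
    exact hqe
  rcases aux_schmidt (mat φ) hdet with ⟨y, z, hyz⟩ | hS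
  · exfalso
    have h1 : φ = fun p : ZMod 3 × ZMod 3 => y p.1 * z p.2 := by
      funext p
      exact congrFun (congrFun hyz p.1) p.2
    have h3 := aux_product ρ hρ y z
    rw [← h1] at h3
    have := (Complex.le_def.mp h3).1
    simp only [Complex.zero_re] at this
    linarith
  · refine ⟨φ, hS, _, hφ, ?_⟩
    have hst : star (star φ ⬝ᵥ (PT ρ *ᵥ φ)) = star φ ⬝ᵥ (PT ρ *ᵥ φ) := by
      rw [← Matrix.star_dotProduct, Matrix.star_mulVec, hH.eq, Matrix.dotProduct_mulVec]
    exact (Complex.conj_eq_iff_re.mp hst).symm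
end

section
/- Let ρ ∈ M_3 be a Bell-diagonal qutrit-qutrit state whose partial transpose ρ^Γ is not positive semidefinite. Then ρ^Γ has exactly one negative eigenvalue value, and this eigenvalue λ_min(ρ^Γ) < 0 occurs with multiplicity three; i.e., ρ^Γ has exactly three negative eigenvalues counting multiplicities, all equal to λ_min(ρ^Γ). -/
open Matrix BigOperators Complex Kronecker
open scoped ComplexOrder

/-- `ω = exp(2πi/d)`. -/
noncomputable def omg (d : ℕ) : ℂ := Complex.exp (2 * Real.pi * Complex.I / (d : ℂ))

/-- `ω^x` for `x : ZMod d`. -/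
noncomputable def wpow (d : ℕ) [NeZero d] (x : ZMod d) : ℂ := omg d ^ x.val

/-- Weyl-Heisenberg operator `W_{k,l} = Σ_j ω^{jk} |j⟩⟨j+l|`. -/
noncomputable def Weyl (d : ℕ) [NeZero d] (k l : ZMod d) : Matrix (ZMod d) (ZMod d) ℂ :=
  Matrix.of fun i j => if j = i + l then wpow d (i * k) else 0

/-- Bell basis vector `|Ω_{k,l}⟩ = (W_{k,l} ⊗ 1)|Ω_{0,0}⟩`, whose `(i,j)` entry is
`(1/√d) (W_{k,l})_{i,j}`. -/
noncomputable def OmegaVec (d : ℕ) [NeZero d] (k l : ZMod d) : ZMod d × ZMod d → ℂ :=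
  fun p => ((1 / Real.sqrt d : ℝ) : ℂ) * Weyl d k l p.1 p.2

/-- Bell projector `P_{k,l} = |Ω_{k,l}⟩⟨Ω_{k,l}|`. -/
noncomputable def BellProj (d : ℕ) [NeZero d] (k l : ZMod d) :
    Matrix (ZMod d × ZMod d) (ZMod d × ZMod d) ℂ :=
  Matrix.of fun p q => OmegaVec d k l p * (starRingEnd ℂ) (OmegaVec d k l q)

lemma sum3m {M : Type*} [AddCommMonoid M] (m : ZMod 3) (f : ZMod 3 → M) :
    ∑ i, f i = f m + f (m+1) + f (m+2) := by
  have h : (Finset.univ : Finset (ZMod 3)) = {m, m+1, m+2} := by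
    revert m; decide
  rw [h, Finset.sum_insert, Finset.sum_insert, Finset.sum_singleton, add_assoc]
  · revert m; decide
  · revert m; decide

lemma omg_pow : omg 3 ^ 3 = 1 := by
  unfold omg
  rw [← Complex.exp_nat_mul]
  push_cast
  rw [show (3:ℂ) * (2 * Real.pi * Complex.I / 3) = 2 * Real.pi * Complex.I by ring]
  exact Complex.exp_two_pi_mul_I

lemma wpow_add (a b : ZMod 3) : wpow 3 (a + b) = wpow 3 a * wpow 3 b := by
  unfold wpow
  rw [← pow_add, ZMod.val_add]
  conv_rhs => rw [← Nat.div_add_mod (a.val + b.val) 3, pow_add, pow_mul, omg_pow, one_pow, one_mul]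

lemma wpow_norm (a : ZMod 3) : ‖wpow 3 a‖ = 1 := by
  unfold wpow
  rw [norm_pow]
  have : ‖omg 3‖ ^ 3 = 1 := by rw [← norm_pow, omg_pow, norm_one]
  rw [(pow_eq_one_iff_of_nonneg (norm_nonneg _) (by norm_num)).1 this, one_pow]

lemma wpow_conj (a : ZMod 3) : wpow 3 a * (starRingEnd ℂ) (wpow 3 a) = 1 := by
  rw [Complex.mul_conj, Complex.normSq_eq_norm_sq, wpow_norm]; simp

lemma pt_entry (c : ZMod 3 → ZMod 3 → ℝ) (p q : ZMod 3 × ZMod 3) :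
    PT (∑ k : ZMod 3, ∑ l : ZMod 3, (c k l : ℂ) • BellProj 3 k l) p q =
    if p.1 + p.2 = q.1 + q.2 then
      ∑ k : ZMod 3, (c k (q.2 - p.1) : ℂ) * ((1/3) * (wpow 3 (p.1 * k) *
        (starRingEnd ℂ) (wpow 3 (q.1 * k)))) else 0 := by
  have h3 : ((√3 : ℝ) : ℂ)⁻¹ * ((√3 : ℝ) : ℂ)⁻¹ = 1/3 := by
    rw [← mul_inv, ← Complex.ofReal_mul, Real.mul_self_sqrt (by norm_num)]; simp
  simp only [PT, Matrix.of_apply, Matrix.sum_apply, Matrix.smul_apply, smul_eq_mul]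
  split_ifs with h
  · refine Finset.sum_congr rfl fun k _ => ?_
    rw [Finset.sum_eq_single (q.2 - p.1)]
    · have h' : p.2 = q.1 + (q.2 - p.1) := by linear_combination h
      simp only [BellProj, OmegaVec, Weyl, Matrix.of_apply, ← h', add_sub_cancel, if_true, map_mul,
        Complex.conj_ofReal]
      rw [← h3]
      push_cast
      simp only [one_div]
      ring
    · intro l _ hl
      have : q.2 ≠ p.1 + l := fun e => hl (by rw [e]; ring)
      simp [BellProj, OmegaVec, Weyl, this]
    · simp
  · refine Finset.sum_eq_zero fun k _ => Finset.sum_eq_zero fun l _ => ?_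
    by_cases h1 : q.2 = p.1 + l
    · have : p.2 ≠ q.1 + l := fun e => h (by rw [e, h1]; ring)
      simp [BellProj, OmegaVec, Weyl, this]
    · simp [BellProj, OmegaVec, Weyl, h1]

lemma psd_two (B : Matrix (ZMod 3) (ZMod 3) ℂ) (a : ZMod 3 → ℝ)
    (hd : ∀ i, B i i = a i) (hB : ∀ i j, ‖B i j‖ ≤ a (-i-j)) (m : ZMod 3)
    (hm : ∀ i, a m ≤ a i) (x : ZMod 3 → ℂ) (hx : x m = 0) :
    0 ≤ (star x ⬝ᵥ B *ᵥ x).re := by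
  simp only [dotProduct, mulVec, sum3m m, hx, Pi.star_apply, star_zero, zero_mul, mul_zero,
    zero_add, hd]
  have h1 := hB (m+1) (m+2)
  have h2 := hB (m+2) (m+1)
  have e : ∀ m : ZMod 3, -(m+1)-(m+2) = m ∧ -(m+2)-(m+1) = m := by decide
  rw [(e m).1] at h1
  rw [(e m).2] at h2
  have k1 := hm (m+1)
  have k2 := hm (m+2)
  have k0 := (norm_nonneg _).trans h1
  generalize B (m+1) (m+2) = z at *
  generalize B (m+2) (m+1) = w at *
  generalize x (m+1) = s at *
  generalize x (m+2) = t at *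
  have n1 : -(a m * ‖s‖ * ‖t‖) ≤ (star s * (z * t)).re := by
    have := (abs_le.1 (Complex.abs_re_le_norm (star s * (z * t)))).1
    rw [norm_mul, norm_mul, norm_star] at this
    have : ‖s‖ * (‖z‖ * ‖t‖) ≤ ‖s‖ * (a m * ‖t‖) := by gcongr
    linarith
  have n2 : -(a m * ‖s‖ * ‖t‖) ≤ (star t * (w * s)).re := by
    have := (abs_le.1 (Complex.abs_re_le_norm (star t * (w * s)))).1
    rw [norm_mul, norm_mul, norm_star] at this
    have : ‖t‖ * (‖w‖ * ‖s‖) ≤ ‖t‖ * (a m * ‖s‖) := by gcongr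
    linarith
  have d : ∀ (r : ℝ) (s : ℂ), (star s * (r * s)).re = r * ‖s‖^2 := by
    intro r s
    rw [Complex.sq_norm, Complex.normSq_apply]
    simp; ring
  rw [mul_add, mul_add, Complex.add_re, Complex.add_re, Complex.add_re, d, d]
  have q1 : a m * ‖s‖^2 ≤ a (m+1) * ‖s‖^2 := by gcongr
  have q2 : a m * ‖t‖^2 ≤ a (m+2) * ‖t‖^2 := by gcongr
  nlinarith [mul_nonneg k0 (sq_nonneg (‖s‖ - ‖t‖))]

lemma neg_uniq3 (B : Matrix (ZMod 3) (ZMod 3) ℂ) (m : ZMod 3)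
    (hp : ∀ x : ZMod 3 → ℂ, x m = 0 → 0 ≤ (star x ⬝ᵥ B *ᵥ x).re)
    (u v : ZMod 3 → ℂ) (r s : ℝ) (hu : B *ᵥ u = (r:ℂ) • u) (hv : B *ᵥ v = (s:ℂ) • v)
    (uu : star u ⬝ᵥ u = 1) (vv : star v ⬝ᵥ v = 1) (uv : star u ⬝ᵥ v = 0)
    (vu : star v ⬝ᵥ u = 0) (hr : r < 0) (hs : s < 0) : False := by
  have h := hp (v m • u - u m • v) (by simp [mul_comm])
  rw [mulVec_sub, mulVec_smul, mulVec_smul, hu, hv] at h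
  simp only [star_sub, star_smul, sub_dotProduct, dotProduct_sub, smul_dotProduct,
    dotProduct_smul, uu, vv, uv, vu, smul_eq_mul, mul_zero, mul_one, sub_zero, zero_sub] at h
  have h' : 0 ≤ r * ‖v m‖^2 + s * ‖u m‖^2 := by
    rw [Complex.sq_norm, Complex.normSq_apply, Complex.sq_norm, Complex.normSq_apply]
    simp at h
    linarith
  have hv0 : v m = 0 := by
    by_contra hne
    have := norm_pos_iff.2 hne
    nlinarith [mul_pos_of_neg_of_neg hr (neg_neg_of_pos (pow_pos this 2)), mul_nonneg_of_nonpos_of_nonpos hs.le (neg_nonpos.2 (sq_nonneg ‖u m‖))]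
  have h2 := hp v hv0
  rw [hv, dotProduct_smul, vv] at h2
  simp at h2
  linarith

lemma charpoly_bd (B : Matrix (ZMod 3) (ZMod 3) ℂ) :
    (blockDiagonal (fun _ : ZMod 3 => B)).charpoly = B.charpoly ^ 3 := by
  have : (blockDiagonal (fun _ : ZMod 3 => B)).charmatrix =
      blockDiagonal (fun _ : ZMod 3 => B.charmatrix) := by
    ext ⟨i, s⟩ ⟨j, t⟩ : 1
    by_cases hst : s = t <;> by_cases hij : i = j <;>
      simp [charmatrix_apply, blockDiagonal_apply, Matrix.diagonal_apply, hst, hij]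
  rw [Matrix.charpoly, this, det_blockDiagonal]
  simp [Matrix.charpoly]

def myE : ZMod 3 × ZMod 3 ≃ ZMod 3 × ZMod 3 where
  toFun p := (2 * p.1 + p.2, p.1 + p.2)
  invFun p := (p.1 - p.2, 2 * p.2 - p.1)
  left_inv p := by ext <;> simp <;> ring
  right_inv p := by ext <;> simp <;> ring

lemma count_eigs {n : Type*} [Fintype n] [DecidableEq n] (A : Matrix n n ℂ) (hA : A.IsHermitian) :
    A.charpoly.roots.countP (fun z => z.re < 0) =
      (Finset.univ.filter fun i => hA.eigenvalues i < 0).card := by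
  rw [hA.roots_charpoly_eq_eigenvalues, Multiset.countP_map]
  simp [Finset.card, Finset.filter]

lemma mem_eigs {n : Type*} [Fintype n] [DecidableEq n] (A : Matrix n n ℂ) (hA : A.IsHermitian)
    (r : ℝ) : (r : ℂ) ∈ A.charpoly.roots ↔ ∃ i, hA.eigenvalues i = r := by
  rw [hA.roots_charpoly_eq_eigenvalues]
  simp

/-- For `ρ ∈ M₃` with `ρ^Γ` not positive semidefinite, `ρ^Γ` has exactly three negative
eigenvalues counting multiplicities, all equal to the smallest eigenvalue `λ_min(ρ^Γ) < 0`. -/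
theorem stmt2 (ρ : Matrix (ZMod 3 × ZMod 3) (ZMod 3 × ZMod 3) ℂ)
    (c : ZMod 3 → ZMod 3 → ℝ) (hc : ∀ k l, 0 ≤ c k l)
    (hsum : ∑ k : ZMod 3, ∑ l : ZMod 3, c k l = 1)
    (hρ : ρ = ∑ k : ZMod 3, ∑ l : ZMod 3, (c k l : ℂ) • BellProj 3 k l)
    (hH : (PT ρ).IsHermitian)
    (hNPT : ¬ (PT ρ).PosSemidef) :
    (⨅ i, hH.eigenvalues i) < 0 ∧
    (Finset.univ.filter fun i => hH.eigenvalues i < 0).card = 3 ∧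
    ∀ i, hH.eigenvalues i < 0 → hH.eigenvalues i = ⨅ j, hH.eigenvalues j := by
  subst hρ
  set ρ := ∑ k : ZMod 3, ∑ l : ZMod 3, (c k l : ℂ) • BellProj 3 k l with hρ
  set B : Matrix (ZMod 3) (ZMod 3) ℂ := (PT ρ).submatrix (fun i => (i, -i)) (fun i => (i, -i))
    with hBdef
  have hBH : B.IsHermitian := hH.submatrix _
  have hBe : ∀ i j, B i j = ∑ k : ZMod 3, (c k (-i-j) : ℂ) * ((1/3) * (wpow 3 (i * k) *
        (starRingEnd ℂ) (wpow 3 (j * k)))) := by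
    intro i j
    simp only [hBdef, Matrix.submatrix_apply, hρ, pt_entry]
    rw [if_pos (by ring), show -j - i = -i - j by ring]
  have hblock : PT ρ = Matrix.reindex myE.symm myE.symm (blockDiagonal (fun _ : ZMod 3 => B)) := by
    ext p q
    rw [Matrix.reindex_apply, Matrix.submatrix_apply, hρ, pt_entry, Equiv.symm_symm]
    rw [blockDiagonal_apply]
    have m1 : ∀ p, (myE p).1 = 2 * p.1 + p.2 := fun _ => rfl
    have m2 : ∀ p, (myE p).2 = p.1 + p.2 := fun _ => rfl
    by_cases h : p.1 + p.2 = q.1 + q.2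
    · rw [if_pos h, if_pos (by rw [m2, m2, h]), hBe, m1, m1]
      refine Finset.sum_congr rfl fun k _ => ?_
      have e1 : -(2 * p.1 + p.2) - (2 * q.1 + q.2) = q.2 - p.1 := by
        have h3 : (3 : ZMod 3) = 0 := rfl
        linear_combination -h - (q.1 + q.2) * h3
      have e2 : 2 * p.1 + p.2 = p.1 + (p.1 + p.2) := by ring
      have e3 : 2 * q.1 + q.2 = q.1 + (p.1 + p.2) := by rw [h]; ring
      rw [e1, e2, e3, add_mul p.1, add_mul q.1, wpow_add (p.1 * k), wpow_add (q.1 * k), map_mul]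
      linear_combination (-(c k (q.2 - p.1) : ℂ) * (1/3) * wpow 3 (p.1 * k) *
        (starRingEnd ℂ) (wpow 3 (q.1 * k))) * wpow_conj ((p.1 + p.2) * k)
    · rw [if_neg h, if_neg (by rw [m2, m2]; exact h)]
  have hroots : (PT ρ).charpoly.roots = 3 • B.charpoly.roots := by
    rw [hblock, Matrix.charpoly_reindex, charpoly_bd, Polynomial.roots_pow]
  -- the diagonal
  set a : ZMod 3 → ℝ := fun i => ∑ k : ZMod 3, c k i * (1/3) with ha
  have hd : ∀ i, B i i = a i := by
    intro i
    rw [hBe]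
    have : -i - i = i := by revert i; decide
    simp only [wpow_conj, this, ha]
    push_cast
    simp
  have hn : ∀ i j, ‖B i j‖ ≤ a (-i-j) := by
    intro i j
    rw [hBe]
    refine (norm_sum_le _ _).trans (Finset.sum_le_sum fun k _ => ?_)
    simp [wpow_norm, abs_of_nonneg (hc _ _)]
  obtain ⟨m, hm⟩ := Finite.exists_min a
  have huniq : ∀ i j, hBH.eigenvalues i < 0 → hBH.eigenvalues j < 0 → i = j := by
    intro i j hi hj
    by_contra hij
    have orth := hBH.eigenvectorBasis.orthonormal
    have hin : ∀ i j, star (⇑(hBH.eigenvectorBasis i)) ⬝ᵥ ⇑(hBH.eigenvectorBasis j) =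
        if i = j then (1:ℂ) else 0 := by
      intro i j
      rw [← orthonormal_iff_ite.1 orth i j, EuclideanSpace.inner_eq_star_dotProduct,
        dotProduct_comm]
    refine neg_uniq3 B m (fun x hx => psd_two B a hd hn m hm x hx)
      (hBH.eigenvectorBasis i) (hBH.eigenvectorBasis j) _ _
      (hBH.mulVec_eigenvectorBasis i) (hBH.mulVec_eigenvectorBasis j) ?_ ?_ ?_ ?_ hi hj
    · simp [hin]
    · simp [hin]
    · simp [hin, hij]
    · simp [hin, Ne.symm hij]
  have hex : ∃ i, hH.eigenvalues i < 0 := by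
    by_contra! hcon
    exact hNPT (hH.posSemidef_iff_eigenvalues_nonneg.2 hcon)
  have htrans : ∀ i, ∃ j, hBH.eigenvalues j = hH.eigenvalues i := by
    intro i
    rw [← mem_eigs B hBH]
    have := (mem_eigs _ hH (hH.eigenvalues i)).2 ⟨i, rfl⟩
    rw [hroots] at this
    exact Multiset.mem_of_mem_nsmul this
  obtain ⟨i0, hi0⟩ := hex
  obtain ⟨j0, hj0⟩ := htrans i0
  have hall : ∀ i, hH.eigenvalues i < 0 → hH.eigenvalues i = hH.eigenvalues i0 := by
    intro i hi
    obtain ⟨j, hj⟩ := htrans i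
    rw [← hj, ← hj0, huniq j j0 (by rw [hj]; exact hi) (by rw [hj0]; exact hi0)]
  have hinf : (⨅ i, hH.eigenvalues i) = hH.eigenvalues i0 := by
    apply le_antisymm
    · exact ciInf_le (Set.finite_range _).bddBelow i0
    · haveI : Nonempty (ZMod 3 × ZMod 3) := ⟨i0⟩
      refine le_ciInf fun i => ?_
      by_cases hi : hH.eigenvalues i < 0
      · exact (hall i hi).ge
      · linarith
  refine ⟨hinf ▸ hi0, ?_, fun i hi => (hall i hi).trans hinf.symm⟩
  rw [← count_eigs _ hH, hroots, Multiset.countP_nsmul, count_eigs B hBH]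
  have : (Finset.univ.filter fun i => hBH.eigenvalues i < 0) = {j0} := by
    ext j
    simp only [Finset.mem_filter, Finset.mem_univ, true_and, Finset.mem_singleton]
    constructor
    · intro hj
      exact huniq _ _ hj (by rw [hj0]; exact hi0)
    · rintro rfl
      rw [hj0]; exact hi0
  rw [this]
  simp
end
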